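/- arXiv:2203.03220 — 4 statements merged into one kernel-verified Lean document; each statement's English description precedes it below -/
import Mathlib

section
/- Let G : ℝ^d → ℝ be a smooth function satisfying the QMC-friendly boundary growth condition, and define f : (0,1)^d → ℝ by f(u) = G(Φ^{-1}(u_1), …, Φ^{-1}(u_d)). Then for every tuple (B_1,…,B_d) of positive reals there exists a constant C < ∞ such that for every subset v ⊆ {1,…,d} and every u ∈ (0,1)^d, |(D_v f)(u)| ≤ C ∏_{i=1}^d [min(u_i, 1−u_i)]^{-B_i − 1{i∈v}}, where 1{i∈v} equals 1 if i ∈ v and 0 otherwise. -/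
open MeasureTheory Filter

/-- The standard normal CDF `Φ(t) = ∫_{-∞}^t (2π)^{-1/2} e^{-s²/2} ds`. -/
noncomputable def stdNormalCDF (t : ℝ) : ℝ :=
  ∫ s in Set.Iic t, (Real.sqrt (2 * Real.pi))⁻¹ * Real.exp (-s ^ 2 / 2)

/-- The mixed partial derivative `D_v f` of `f : ℝ^d → ℝ`, taken exactly once with
respect to each coordinate `z_i` with `i ∈ v` (and `D_∅ f = f`). -/
noncomputable def mixedPartial {d : ℕ} (f : (Fin d → ℝ) → ℝ) (v : Finset (Fin d)) :
    (Fin d → ℝ) → ℝ :=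
  fun z => iteratedFDeriv ℝ v.card f z
    (fun j => Pi.single ((v.sort (· ≤ ·)).get ⟨j.1, by simp⟩) 1)

/-- `G : ℝ^d → ℝ` satisfies the QMC-friendly boundary growth condition if for every tuple
of positive reals `(B_1, …, B_d)` there is a constant `B < ∞` with
`|(D_v G)(z)| ≤ B ∏_i (1 - Φ(|z_i|))^{-B_i}` for all `z` and all `v ⊆ {1,…,d}`. -/
def BoundaryGrowthCondition {d : ℕ} (G : (Fin d → ℝ) → ℝ) : Prop :=
  ∀ B : Fin d → ℝ, (∀ i, 0 < B i) →
    ∃ C : ℝ, ∀ (v : Finset (Fin d)) (z : Fin d → ℝ),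
      |mixedPartial G v z| ≤ C * ∏ i, (1 - stdNormalCDF |z i|) ^ (-(B i))

/-- `Φ⁻¹ : (0,1) → ℝ`, the inverse of the standard normal CDF. -/
noncomputable def probit : ℝ → ℝ := Function.invFun stdNormalCDF

open scoped ContDiff Topology

lemma stdNormalCDF_eq_setIntegral (t : ℝ) :
    stdNormalCDF t = ∫ s in Set.Iic t, ProbabilityTheory.gaussianPDFReal 0 1 s := by
  simp [stdNormalCDF, ProbabilityTheory.gaussianPDFReal]

lemma stdNormalCDF_eq_cdf (t : ℝ) :
    stdNormalCDF t = ProbabilityTheory.cdf (ProbabilityTheory.gaussianReal 0 1) t := by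
  rw [ProbabilityTheory.cdf_eq_real, measureReal_def,
    ProbabilityTheory.gaussianReal_apply_eq_integral 0 one_ne_zero, ENNReal.toReal_ofReal,
    stdNormalCDF_eq_setIntegral]
  exact setIntegral_nonneg measurableSet_Iic
    fun x _ => ProbabilityTheory.gaussianPDFReal_nonneg 0 1 x

lemma contDiff_gaussianPDFReal : ContDiff ℝ ∞ (ProbabilityTheory.gaussianPDFReal 0 1) := by
  unfold ProbabilityTheory.gaussianPDFReal
  fun_prop

lemma hasDerivAt_stdNormalCDF (t : ℝ) :
    HasDerivAt stdNormalCDF (ProbabilityTheory.gaussianPDFReal 0 1 t) t := by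
  have hint := ProbabilityTheory.integrable_gaussianPDFReal 0 1
  have hcont := contDiff_gaussianPDFReal.continuous
  have hEq : stdNormalCDF = fun t => stdNormalCDF 0 +
      ∫ s in (0 : ℝ)..t, ProbabilityTheory.gaussianPDFReal 0 1 s := by
    ext t
    rw [← intervalIntegral.integral_Iic_sub_Iic hint.integrableOn hint.integrableOn,
      stdNormalCDF_eq_setIntegral, stdNormalCDF_eq_setIntegral]
    ring
  rw [hEq]
  exact (intervalIntegral.integral_hasDerivAt_right (hcont.intervalIntegrable _ _)
    hcont.stronglyMeasurable.stronglyMeasurableAtFilter hcont.continuousAt).const_add _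

lemma contDiff_stdNormalCDF : ContDiff ℝ ∞ stdNormalCDF := by
  refine contDiff_infty_iff_deriv.2 ⟨fun t => (hasDerivAt_stdNormalCDF t).differentiableAt, ?_⟩
  rw [deriv_eq hasDerivAt_stdNormalCDF]
  exact contDiff_gaussianPDFReal

lemma strictMono_stdNormalCDF : StrictMono stdNormalCDF :=
  strictMono_of_hasDerivAt_pos hasDerivAt_stdNormalCDF
    fun t => ProbabilityTheory.gaussianPDFReal_pos 0 1 t one_ne_zero

lemma probit_stdNormalCDF (t : ℝ) : probit (stdNormalCDF t) = t :=
  Function.leftInverse_invFun strictMono_stdNormalCDF.injective t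

lemma stdNormalCDF_probit {u : ℝ} (hu : u ∈ Set.Ioo (0 : ℝ) 1) : stdNormalCDF (probit u) = u := by
  refine Function.invFun_eq ?_
  have h0 : Tendsto stdNormalCDF atBot (𝓝 0) := by
    simpa only [funext stdNormalCDF_eq_cdf] using ProbabilityTheory.tendsto_cdf_atBot _
  have h1 : Tendsto stdNormalCDF atTop (𝓝 1) := by
    simpa only [funext stdNormalCDF_eq_cdf] using ProbabilityTheory.tendsto_cdf_atTop _
  exact mem_range_of_exists_le_of_exists_ge contDiff_stdNormalCDF.continuous
    ((h0.eventually_le_const hu.1).exists) ((h1.eventually_const_le hu.2).exists)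

lemma contDiffAt_probit_stdNormalCDF (t : ℝ) : ContDiffAt ℝ ∞ probit (stdNormalCDF t) := by
  have hne : ProbabilityTheory.gaussianPDFReal 0 1 t ≠ 0 :=
    (ProbabilityTheory.gaussianPDFReal_pos 0 1 t one_ne_zero).ne'
  have hf := contDiff_stdNormalCDF.contDiffAt (x := t)
  have hf' : HasFDerivAt stdNormalCDF
      (ContinuousLinearEquiv.unitsEquivAut ℝ (Units.mk0 _ hne) : ℝ →L[ℝ] ℝ) t :=
    (hasDerivAt_stdNormalCDF t).hasFDerivAt_equiv hne
  have hn : (∞ : WithTop ℕ∞) ≠ 0 := by simp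
  refine (hf.to_localInverse hf' hn).congr_of_eventuallyEq ?_
  exact (hf.hasStrictFDerivAt' hf' hn).localInverse_unique (.of_forall probit_stdNormalCDF)

lemma contDiffAt_probit {u : ℝ} (hu : u ∈ Set.Ioo (0 : ℝ) 1) : ContDiffAt ℝ ∞ probit u := by
  simpa only [stdNormalCDF_probit hu] using contDiffAt_probit_stdNormalCDF (probit u)

lemma hasDerivAt_probit {u : ℝ} (hu : u ∈ Set.Ioo (0 : ℝ) 1) :
    HasDerivAt probit (ProbabilityTheory.gaussianPDFReal 0 1 (probit u))⁻¹ u := by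
  refine HasDerivAt.of_local_left_inverse (contDiffAt_probit hu).continuousAt
    (hasDerivAt_stdNormalCDF (probit u))
    (ProbabilityTheory.gaussianPDFReal_pos 0 1 _ one_ne_zero).ne' ?_
  filter_upwards [Ioo_mem_nhds hu.1 hu.2] with w hw using stdNormalCDF_probit hw

lemma one_sub_stdNormalCDF (t : ℝ) :
    1 - stdNormalCDF t = ∫ s in Set.Ioi t, ProbabilityTheory.gaussianPDFReal 0 1 s := by
  have hint := ProbabilityTheory.integrable_gaussianPDFReal 0 1
  rw [stdNormalCDF_eq_setIntegral, ← ProbabilityTheory.integral_gaussianPDFReal_eq_one 0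
    one_ne_zero, ← Set.compl_Iic, setIntegral_compl measurableSet_Iic hint]

lemma stdNormalCDF_neg (t : ℝ) : stdNormalCDF (-t) = 1 - stdNormalCDF t := by
  rw [one_sub_stdNormalCDF, stdNormalCDF_eq_setIntegral, ← neg_neg t, ← integral_comp_neg_Iic]
  simp [ProbabilityTheory.gaussianPDFReal]

lemma min_stdNormalCDF (t : ℝ) :
    min (stdNormalCDF t) (1 - stdNormalCDF t) = 1 - stdNormalCDF |t| := by
  rw [← stdNormalCDF_neg, ← stdNormalCDF_neg, ← strictMono_stdNormalCDF.monotone.map_min,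
    min_def, abs]
  congr 1
  rcases le_total t 0 with h | h
  · rw [if_pos (by linarith), sup_eq_right.2 (by linarith), neg_neg]
  · rw [sup_eq_left.2 (by linarith)]
    split_ifs <;> linarith

/-- The upper tail of the normal distribution is at most a constant times its density. -/
lemma one_sub_stdNormalCDF_abs_le (t : ℝ) :
    1 - stdNormalCDF |t| ≤ √(2 * Real.pi) * ProbabilityTheory.gaussianPDFReal 0 1 t := by
  have hpi : 0 < √(2 * Real.pi) := by positivity
  have hrhs : √(2 * Real.pi) * ProbabilityTheory.gaussianPDFReal 0 1 t =
      ∫ s, Real.exp (-t ^ 2 / 2) * ProbabilityTheory.gaussianPDFReal |t| 1 s := by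
    rw [integral_const_mul, ProbabilityTheory.integral_gaussianPDFReal_eq_one _ one_ne_zero]
    simp [ProbabilityTheory.gaussianPDFReal]
    field_simp
  have hint := (ProbabilityTheory.integrable_gaussianPDFReal |t| 1).const_mul
    (Real.exp (-t ^ 2 / 2))
  rw [one_sub_stdNormalCDF, hrhs]
  refine (setIntegral_mono_on (ProbabilityTheory.integrable_gaussianPDFReal 0 1).integrableOn
    hint.integrableOn measurableSet_Ioi fun s hs => ?_).trans
    (setIntegral_le_integral hint (.of_forall fun s => ?_))
  · simp only [ProbabilityTheory.gaussianPDFReal, NNReal.coe_one, mul_one, sub_zero]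
    rw [mul_left_comm, ← Real.exp_add]
    gcongr
    nlinarith [mul_nonneg (abs_nonneg t) (sub_nonneg.2 (Set.mem_Ioi.1 hs).le), sq_abs t]
  · exact mul_nonneg (Real.exp_pos _).le (ProbabilityTheory.gaussianPDFReal_nonneg _ _ _)

/-- Chain rule for iterated partial derivatives, at most one per coordinate, of a function
precomposed with the coordinatewise application of `g`. -/
lemma iteratedFDeriv_comp_coordinatewise {d : ℕ} {G : (Fin d → ℝ) → ℝ} (hG : ContDiff ℝ ∞ G)
    {g g' : ℝ → ℝ} {s : Set ℝ} (hs : IsOpen s) (hg : ∀ x ∈ s, ContDiffAt ℝ ∞ g x)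
    (hg' : ∀ x ∈ s, HasDerivAt g (g' x) x) (l : List (Fin d)) (hl : l.Nodup)
    (u : Fin d → ℝ) (hu : ∀ i, u i ∈ s) :
    iteratedFDeriv ℝ l.length (fun w => G fun i => g (w i)) u
        (fun j => Pi.single (l.get j) 1) =
      iteratedFDeriv ℝ l.length G (fun i => g (u i)) (fun j => Pi.single (l.get j) 1) *
        (l.map fun i => g' (u i)).prod := by
  induction l generalizing u with
  | nil => simp
  | cons i l ih =>
    obtain ⟨hil, hl⟩ := List.nodup_cons.1 hl
    have hf : ContDiffAt ℝ ∞ (fun w : Fin d → ℝ => G fun i => g (w i)) u :=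
      hG.contDiffAt.comp u
        (contDiffAt_pi.2 fun k => (hg _ (hu k)).comp u (contDiff_apply ℝ ℝ k).contDiffAt)
    have hdf : DifferentiableAt ℝ
        (iteratedFDeriv ℝ l.length fun w : Fin d → ℝ => G fun i => g (w i)) u :=
      (hf.iteratedFDeriv_right (m := 1) (by exact_mod_cast le_top)).differentiableAt one_ne_zero
    have hdG : DifferentiableAt ℝ (iteratedFDeriv ℝ l.length G) (fun i => g (u i)) :=
      (hG.contDiffAt.iteratedFDeriv_right (m := 1)
        (by exact_mod_cast le_top)).differentiableAt one_ne_zero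
    have hline (x : Fin d → ℝ) (t : ℝ) :
        HasDerivAt (fun r : ℝ => Function.update x i r) (Pi.single i 1) t :=
      hasDerivAt_update x i t
    set m : Fin l.length → Fin d → ℝ := fun j => Pi.single (l.get j) 1
    have key (F : (Fin d → ℝ) → ℝ) (x y : Fin d → ℝ)
        (hF : DifferentiableAt ℝ (iteratedFDeriv ℝ l.length F) x) {γ : ℝ → Fin d → ℝ} {t : ℝ}
        (hγ : HasDerivAt γ y t) (hx : γ t = x) :
        HasDerivAt (fun r => iteratedFDeriv ℝ l.length F (γ r) m)
          (fderiv ℝ (iteratedFDeriv ℝ l.length F) x y m) t := by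
      subst hx
      exact (ContinuousMultilinearMap.apply ℝ (fun _ : Fin l.length => Fin d → ℝ) ℝ
        m).hasFDerivAt.comp_hasDerivAt t (hF.hasFDerivAt.comp_hasDerivAt t hγ)
    have h1 := key _ u _ hdf (hline u (u i)) (Function.update_eq_self i u)
    have hγ : HasDerivAt (fun r k => g (Function.update u i r k)) (g' (u i) • Pi.single i 1)
        (u i) := by
      refine hasDerivAt_pi.2 fun k => ?_
      by_cases hk : k = i
      · subst hk
        simpa using hg' _ (hu k)
      · simpa [hk] using hasDerivAt_const (u i) (g (u k))
    have h2 := (key G (fun k => g (u k)) _ hdG hγ (by simp)).mul_const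
      (l.map fun i => g' (u i)).prod
    have hEq : (fun r => iteratedFDeriv ℝ l.length (fun w : Fin d → ℝ => G fun i => g (w i))
          (Function.update u i r) m) =ᶠ[𝓝 (u i)]
        fun r => iteratedFDeriv ℝ l.length G (fun k => g (Function.update u i r k)) m *
          (l.map fun i => g' (u i)).prod := by
      filter_upwards [hs.mem_nhds (hu i)] with r hr
      rw [ih hl (Function.update u i r) fun k => ?_]
      · congr 2
        refine List.map_congr_left fun k hk => ?_
        have hki : k ≠ i := ne_of_mem_of_not_mem hk hil
        rw [Function.update_of_ne hki]
      · by_cases hk : k = i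
        · subst hk; simpa using hr
        · simpa [hk] using hu k
    have h3 := h1.unique (h2.congr_of_eventuallyEq hEq)
    have htail : Fin.tail (fun j : Fin (l.length + 1) =>
        (Pi.single ((i :: l).get j) 1 : Fin d → ℝ)) = m := rfl
    simp only [List.length_cons, List.map_cons, List.prod_cons]
    rw [iteratedFDeriv_succ_apply_left, iteratedFDeriv_succ_apply_left, htail]
    refine h3.trans ?_
    simp
    ring

lemma mixedPartial_eq_iteratedFDeriv_sort {d : ℕ} (f : (Fin d → ℝ) → ℝ) (v : Finset (Fin d))
    (z : Fin d → ℝ) :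
    mixedPartial f v z = iteratedFDeriv ℝ (v.sort (· ≤ ·)).length f z
      (fun j => Pi.single ((v.sort (· ≤ ·)).get j) 1) := by
  have aux (n : ℕ) (l : List (Fin d)) (h : l.length = n) :
      iteratedFDeriv ℝ n f z (fun j => Pi.single (l.get ⟨j.1, h ▸ j.2⟩) 1) =
        iteratedFDeriv ℝ l.length f z (fun j => Pi.single (l.get j) 1) := by
    subst h; rfl
  exact aux _ _ (by simp)

lemma mixedPartial_comp_coordinatewise {d : ℕ} {G : (Fin d → ℝ) → ℝ} (hG : ContDiff ℝ ∞ G)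
    {g g' : ℝ → ℝ} {s : Set ℝ} (hs : IsOpen s) (hg : ∀ x ∈ s, ContDiffAt ℝ ∞ g x)
    (hg' : ∀ x ∈ s, HasDerivAt g (g' x) x) (v : Finset (Fin d))
    (u : Fin d → ℝ) (hu : ∀ i, u i ∈ s) :
    mixedPartial (fun w => G fun i => g (w i)) v u =
      mixedPartial G v (fun i => g (u i)) * ∏ i ∈ v, g' (u i) := by
  rw [mixedPartial_eq_iteratedFDeriv_sort, mixedPartial_eq_iteratedFDeriv_sort,
    iteratedFDeriv_comp_coordinatewise hG hs hg hg' _ (v.sort_nodup _) u hu,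
    ← List.prod_toFinset _ (v.sort_nodup _), Finset.sort_toFinset]

/-- if `G` is smooth and satisfies the QMC-friendly boundary growth
condition, then `f(u) = G(Φ⁻¹(u_1), …, Φ⁻¹(u_d))` satisfies
`|(D_v f)(u)| ≤ C ∏_i min(u_i, 1-u_i)^{-B_i - 1{i ∈ v}}` on `(0,1)^d`. -/
theorem transformed_integrand_growth
    {d : ℕ} (G : (Fin d → ℝ) → ℝ) (hG : ContDiff ℝ (⊤ : ℕ∞) G)
    (hbgc : BoundaryGrowthCondition G)
    (B : Fin d → ℝ) (hB : ∀ i, 0 < B i) :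
    ∃ C : ℝ, ∀ (v : Finset (Fin d)) (u : Fin d → ℝ),
      (∀ i, u i ∈ Set.Ioo (0 : ℝ) 1) →
      |mixedPartial (fun w => G (fun i => probit (w i))) v u| ≤
        C * ∏ i, (min (u i) (1 - u i)) ^ (-(B i) - (if i ∈ v then (1 : ℝ) else 0)) := by
  obtain ⟨C, hC⟩ := hbgc B hB
  set K : ℝ := √(2 * Real.pi)
  have hK1 : 1 ≤ K := Real.one_le_sqrt.2 (by linarith [Real.pi_gt_three])
  refine ⟨|C| * K ^ d, fun v u hu => ?_⟩
  have hmin (i) : min (u i) (1 - u i) = 1 - stdNormalCDF |probit (u i)| := by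
    rw [← min_stdNormalCDF, stdNormalCDF_probit (hu i)]
  have hpos (i) : 0 < min (u i) (1 - u i) := lt_min (hu i).1 (sub_pos.2 (hu i).2)
  have hφ (i) : 0 < ProbabilityTheory.gaussianPDFReal 0 1 (probit (u i)) :=
    ProbabilityTheory.gaussianPDFReal_pos 0 1 _ one_ne_zero
  have hprod : ∏ i ∈ v, (ProbabilityTheory.gaussianPDFReal 0 1 (probit (u i)))⁻¹ ≤
      K ^ d * ∏ i ∈ v, (min (u i) (1 - u i))⁻¹ := by
    calc ∏ i ∈ v, (ProbabilityTheory.gaussianPDFReal 0 1 (probit (u i)))⁻¹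
        ≤ ∏ i ∈ v, K * (min (u i) (1 - u i))⁻¹ := by
          refine Finset.prod_le_prod (fun i _ => (inv_pos.2 (hφ i)).le) fun i _ => ?_
          rw [← div_eq_mul_inv, le_div_iff₀ (hpos i), inv_mul_le_iff₀ (hφ i), mul_comm, hmin]
          exact one_sub_stdNormalCDF_abs_le _
      _ = K ^ v.card * ∏ i ∈ v, (min (u i) (1 - u i))⁻¹ := by
          rw [Finset.prod_mul_distrib, Finset.prod_const]
      _ ≤ K ^ d * ∏ i ∈ v, (min (u i) (1 - u i))⁻¹ := by
          gcongr
          · exact Finset.prod_nonneg fun i _ => (inv_pos.2 (hpos i)).le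
          · simpa using v.card_le_univ
  have hG' : |mixedPartial G v fun i => probit (u i)| ≤
      |C| * ∏ i, (min (u i) (1 - u i)) ^ (-(B i)) := by
    refine (hC v _).trans ?_
    simp only [← hmin]
    gcongr
    · exact Finset.prod_nonneg fun i _ => Real.rpow_nonneg (hpos i).le _
    · exact le_abs_self C
  have hsplit : ∏ i, (min (u i) (1 - u i)) ^ (-(B i) - (if i ∈ v then (1 : ℝ) else 0)) =
      (∏ i, (min (u i) (1 - u i)) ^ (-(B i))) * ∏ i ∈ v, (min (u i) (1 - u i))⁻¹ := by
    have hind : ∏ i ∈ v, (min (u i) (1 - u i))⁻¹ =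
        ∏ i, if i ∈ v then (min (u i) (1 - u i))⁻¹ else 1 := by simp
    rw [hind, ← Finset.prod_mul_distrib]
    refine Finset.prod_congr rfl fun i _ => ?_
    split_ifs
    · rw [Real.rpow_sub_one (hpos i).ne', div_eq_mul_inv]
    · simp
  rw [mixedPartial_comp_coordinatewise hG isOpen_Ioo (fun _ => contDiffAt_probit)
    (fun _ => hasDerivAt_probit) v u hu, abs_mul,
    abs_of_nonneg (Finset.prod_nonneg fun i _ => (inv_pos.2 (hφ i)).le), hsplit]
  calc _ ≤ (|C| * ∏ i, (min (u i) (1 - u i)) ^ (-(B i))) *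
        (K ^ d * ∏ i ∈ v, (min (u i) (1 - u i))⁻¹) :=
        mul_le_mul hG' hprod (Finset.prod_nonneg fun i _ => (inv_pos.2 (hφ i)).le)
          ((abs_nonneg _).trans hG')
    _ = _ := by ring
end

section
/- If G₁ : ℝ^d → ℝ and G₂ : ℝ^d → ℝ are smooth functions that each satisfy the QMC-friendly boundary growth condition, then their pointwise product G(z) = G₁(z)·G₂(z) is smooth and also satisfies the QMC-friendly boundary growth condition. (The proof uses the Leibniz rule D_u(G₁G₂)(z) = Σ_{v ⊆ u} (D_v G₁)(z)(D_{u∖v} G₂)(z).) -/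
open MeasureTheory Filter

theorem mixedPartial_eq_list {d : ℕ} (f : (Fin d → ℝ) → ℝ) (v : Finset (Fin d))
    (l : List (Fin d)) (hl : v.sort (· ≤ ·) = l) (z : Fin d → ℝ) :
    mixedPartial f v z = iteratedFDeriv ℝ l.length f z (fun j => Pi.single (l.get j) 1) := by
  have cast_length : ∀ (n : ℕ) (h : n = l.length),
      iteratedFDeriv ℝ n f z (fun j => Pi.single (l.get ⟨j.1, h ▸ j.2⟩) 1) =
        iteratedFDeriv ℝ l.length f z (fun j => Pi.single (l.get j) 1) := by
    rintro n rfl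
    rfl
  subst hl
  exact cast_length v.card (by simp)

theorem mixedPartial_empty {d : ℕ} (f : (Fin d → ℝ) → ℝ) : mixedPartial f ∅ = f := by
  funext z
  rw [mixedPartial_eq_list f ∅ [] (by simp)]
  simp

theorem differentiable_mixedPartial {d : ℕ} {f : (Fin d → ℝ) → ℝ}
    (hf : ContDiff ℝ (⊤ : ℕ∞) f) (v : Finset (Fin d)) : Differentiable ℝ (mixedPartial f v) :=
  fun z => ((hf.differentiable_iteratedFDeriv
    (mod_cast ENat.natCast_lt_top v.card) z).hasFDerivAt.continuousMultilinear_apply_const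
      _).differentiableAt

theorem mixedPartial_insert_min {d : ℕ} {f : (Fin d → ℝ) → ℝ} (hf : ContDiff ℝ (⊤ : ℕ∞) f)
    {a : Fin d} {v : Finset (Fin d)} (ha : ∀ b ∈ v, a < b) (z : Fin d → ℝ) :
    mixedPartial f (insert a v) z = fderiv ℝ (mixedPartial f v) z (Pi.single a 1) := by
  have hsort : (insert a v).sort (· ≤ ·) = a :: v.sort (· ≤ ·) :=
    Finset.sort_insert (· ≤ ·) (fun b hb => (ha b hb).le) fun h => lt_irrefl a (ha a h)
  rw [mixedPartial_eq_list f _ _ hsort,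
    funext (mixedPartial_eq_list f v _ rfl),
    fderiv_continuousMultilinear_apply_const_apply
      (hf.differentiable_iteratedFDeriv (mod_cast ENat.natCast_lt_top _) z)]
  rfl

/-- The Leibniz rule for mixed partial derivatives. -/
theorem mixedPartial_mul {d : ℕ} {f g : (Fin d → ℝ) → ℝ} (hf : ContDiff ℝ (⊤ : ℕ∞) f)
    (hg : ContDiff ℝ (⊤ : ℕ∞) g) (u : Finset (Fin d)) (z : Fin d → ℝ) :
    mixedPartial (fun x => f x * g x) u z =
      ∑ v ∈ u.powerset, mixedPartial f v z * mixedPartial g (u \ v) z := by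
  induction u using Finset.induction_on_min generalizing z with
  | empty => simp [mixedPartial_empty]
  | insert a s ha ih =>
    have has : a ∉ s := fun h => lt_irrefl a (ha a h)
    rw [mixedPartial_insert_min (hf.mul hg) ha, funext ih,
      fderiv_fun_sum fun v _ => (differentiable_mixedPartial hf v z).fun_mul
        (differentiable_mixedPartial hg (s \ v) z),
      Finset.sum_powerset_insert has, ← Finset.sum_add_distrib, sum_apply]
    refine Finset.sum_congr rfl fun v hv => ?_
    have hvs := Finset.mem_powerset.1 hv
    have hav : a ∉ v := fun h => has (hvs h)
    rw [fderiv_fun_mul (differentiable_mixedPartial hf v z)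
        (differentiable_mixedPartial hg (s \ v) z),
      Finset.insert_sdiff_of_notMem _ hav, Finset.insert_sdiff_insert,
      Finset.sdiff_insert_of_notMem has,
      mixedPartial_insert_min hf fun b hb => ha b (hvs hb),
      mixedPartial_insert_min hg fun b hb => ha b (Finset.sdiff_subset hb)]
    simp only [add_apply, smul_apply, smul_eq_mul]
    ring

theorem stdNormalCDF_le_one (t : ℝ) : stdNormalCDF t ≤ 1 := by
  have hpdf : (fun s : ℝ => (Real.sqrt (2 * Real.pi))⁻¹ * Real.exp (-s ^ 2 / 2)) =
      ProbabilityTheory.gaussianPDFReal 0 1 := by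
    simp [ProbabilityTheory.gaussianPDFReal_def]
  rw [stdNormalCDF, hpdf, ← ProbabilityTheory.integral_gaussianPDFReal_eq_one 0 one_ne_zero]
  exact setIntegral_le_integral (ProbabilityTheory.integrable_gaussianPDFReal 0 1)
    (ae_of_all _ (ProbabilityTheory.gaussianPDFReal_nonneg 0 1))

/-- the product of two smooth functions each satisfying the QMC-friendly
boundary growth condition is smooth and satisfies the condition as well. -/
theorem boundaryGrowth_mul
    {d : ℕ} (G₁ G₂ : (Fin d → ℝ) → ℝ)
    (h₁ : ContDiff ℝ (⊤ : ℕ∞) G₁) (h₂ : ContDiff ℝ (⊤ : ℕ∞) G₂)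
    (hb₁ : BoundaryGrowthCondition G₁) (hb₂ : BoundaryGrowthCondition G₂) :
    ContDiff ℝ (⊤ : ℕ∞) (fun z => G₁ z * G₂ z) ∧
    BoundaryGrowthCondition (fun z => G₁ z * G₂ z) := by
  refine ⟨h₁.mul h₂, fun B hB => ?_⟩
  obtain ⟨C₁, hC₁⟩ := hb₁ (fun i => B i / 2) fun i => half_pos (hB i)
  obtain ⟨C₂, hC₂⟩ := hb₂ (fun i => B i / 2) fun i => half_pos (hB i)
  refine ⟨2 ^ d * (C₁ * C₂), fun u z => ?_⟩
  set P := ∏ i, (1 - stdNormalCDF |z i|) ^ (-(B i / 2)) with hP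
  have hPP : ∏ i, (1 - stdNormalCDF |z i|) ^ (-(B i)) = P * P := by
    rw [hP, ← Finset.prod_mul_distrib]
    refine Finset.prod_congr rfl fun i _ => ?_
    rw [← pow_two, ← Real.rpow_mul_natCast (sub_nonneg.2 (stdNormalCDF_le_one _))]
    congr 1
    push_cast
    ring
  have hbound : ∀ v w, |mixedPartial G₁ v z * mixedPartial G₂ w z| ≤ C₁ * P * (C₂ * P) := by
    intro v w
    rw [abs_mul]
    exact mul_le_mul (hC₁ v z) (hC₂ w z) (abs_nonneg _) ((abs_nonneg _).trans (hC₁ v z))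
  have hcard : (2 : ℝ) ^ u.card ≤ 2 ^ d :=
    pow_le_pow_right₀ one_le_two (by simpa using u.card_le_univ)
  rw [mixedPartial_mul h₁ h₂, hPP]
  calc |∑ v ∈ u.powerset, mixedPartial G₁ v z * mixedPartial G₂ (u \ v) z|
      ≤ ∑ v ∈ u.powerset, |mixedPartial G₁ v z * mixedPartial G₂ (u \ v) z| :=
        Finset.abs_sum_le_sum_abs _ _
    _ ≤ ∑ _v ∈ u.powerset, C₁ * P * (C₂ * P) :=
        Finset.sum_le_sum fun v _ => hbound v (u \ v)
    _ = 2 ^ u.card * (C₁ * P * (C₂ * P)) := by simp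
    _ ≤ 2 ^ d * (C₁ * P * (C₂ * P)) :=
        mul_le_mul_of_nonneg_right hcard ((abs_nonneg _).trans (hbound ∅ ∅))
    _ = 2 ^ d * (C₁ * C₂) * (P * P) := by ring
end

section
/- Let c > 0, σ > 0, μ⋆ ∈ ℝ and Σ⋆ ∈ (0,1). Define the Laplace importance sampling integrand F(z) = √Σ⋆ · (1 + c e^{σz})^{-1} · exp( ((1−Σ⋆)/2) z² − μ⋆ √Σ⋆ z − μ⋆²/2 ). Then for every κ with 0 < κ < (1−Σ⋆)/2, there exist constants c₀ > 0 and M > 0 such that F(z) ≥ c₀ exp(κ z²) whenever |z| ≥ M. In particular, F(z) → +∞ as z → +∞ and as z → −∞. -/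
open Filter

lemma one_add_mul_exp_le {c σ : ℝ} (hc : 0 < c) (hσ : 0 < σ) (z : ℝ) :
    1 + c * Real.exp (σ * z) ≤ (1 + c) * Real.exp (σ * |z|) := by
  have h1 : 1 ≤ Real.exp (σ * |z|) := Real.one_le_exp (by positivity)
  have h2 : Real.exp (σ * z) ≤ Real.exp (σ * |z|) :=
    Real.exp_le_exp.2 (mul_le_mul_of_nonneg_left (le_abs_self z) hσ.le)
  nlinarith [mul_le_mul_of_nonneg_left h2 hc.le]

/-- A quadratic with leading coefficient `a > κ` dominates `κ z²` plus linear terms for large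
`|z|`. -/
lemma mul_sq_le_of_div_le_abs {a κ b σ z : ℝ} (hκ : κ < a) (hz : (|b| + σ) / (a - κ) ≤ |z|) :
    κ * z ^ 2 ≤ a * z ^ 2 - b * z - σ * |z| := by
  have h1 : |b| + σ ≤ |z| * (a - κ) := (div_le_iff₀ (sub_pos.2 hκ)).1 hz
  have h2 : b * z ≤ |b| * |z| := (le_abs_self _).trans (abs_mul b z).le
  have h3 := mul_le_mul_of_nonneg_right h1 (abs_nonneg z)
  nlinarith [sq_abs z]

lemma tendsto_mul_exp_mul_sq {c₀ κ : ℝ} (hc₀ : 0 < c₀) (hκ : 0 < κ) {l : Filter ℝ}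
    (hl : Tendsto (fun z : ℝ => |z|) l atTop) :
    Tendsto (fun z : ℝ => c₀ * Real.exp (κ * z ^ 2)) l atTop := by
  have hsq : Tendsto (fun z : ℝ => z ^ 2) l atTop := by
    simpa only [Function.comp_def, sq_abs] using (tendsto_pow_atTop two_ne_zero).comp hl
  exact (Real.tendsto_exp_atTop.comp (hsq.const_mul_atTop hκ)).const_mul_atTop hc₀

/-- the Laplace importance sampling integrand in the Rendleman–Bartter
example grows at least like `exp(κ z²)` for any `0 < κ < (1-Σ⋆)/2`, and in particular
tends to `+∞` as `z → ±∞`. -/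
theorem lapIS_integrand_blows_up
    (c σ μs Sigs : ℝ) (hc : 0 < c) (hσ : 0 < σ) (hSigs : Sigs ∈ Set.Ioo (0 : ℝ) 1)
    (F : ℝ → ℝ)
    (hF : ∀ z, F z = Real.sqrt Sigs * (1 + c * Real.exp (σ * z))⁻¹ *
      Real.exp ((1 - Sigs) / 2 * z ^ 2 - μs * Real.sqrt Sigs * z - μs ^ 2 / 2)) :
    (∀ κ : ℝ, 0 < κ → κ < (1 - Sigs) / 2 →
      ∃ c₀ > (0 : ℝ), ∃ M > (0 : ℝ), ∀ z : ℝ, M ≤ |z| →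
        c₀ * Real.exp (κ * z ^ 2) ≤ F z) ∧
    Tendsto F atTop atTop ∧ Tendsto F atBot atTop := by
  obtain ⟨hS0, hS1⟩ := hSigs
  have hbound : ∀ κ : ℝ, 0 < κ → κ < (1 - Sigs) / 2 →
      ∃ c₀ > (0 : ℝ), ∃ M > (0 : ℝ), ∀ z : ℝ, M ≤ |z| →
        c₀ * Real.exp (κ * z ^ 2) ≤ F z := by
    intro κ _ hκ
    have hs : 0 < Real.sqrt Sigs := Real.sqrt_pos.2 hS0
    have hgap : 0 < (1 - Sigs) / 2 - κ := sub_pos.2 hκ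
    refine ⟨Real.sqrt Sigs * (1 + c)⁻¹ * Real.exp (-(μs ^ 2 / 2)), by positivity,
      (|μs * Real.sqrt Sigs| + σ) / ((1 - Sigs) / 2 - κ), by positivity, fun z hz => ?_⟩
    have hquad := mul_sq_le_of_div_le_abs hκ hz
    have hinv : (1 + c)⁻¹ * Real.exp (-(σ * |z|)) ≤ (1 + c * Real.exp (σ * z))⁻¹ := by
      rw [Real.exp_neg, ← mul_inv]
      exact inv_anti₀ (by positivity) (one_add_mul_exp_le hc hσ z)
    rw [hF z]
    calc Real.sqrt Sigs * (1 + c)⁻¹ * Real.exp (-(μs ^ 2 / 2)) * Real.exp (κ * z ^ 2)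
        = Real.sqrt Sigs * (1 + c)⁻¹ * Real.exp (κ * z ^ 2 - μs ^ 2 / 2) := by
          rw [mul_assoc, ← Real.exp_add]
          ring_nf
      _ ≤ Real.sqrt Sigs * (1 + c)⁻¹ * Real.exp (-(σ * |z|) +
            ((1 - Sigs) / 2 * z ^ 2 - μs * Real.sqrt Sigs * z - μs ^ 2 / 2)) := by
          gcongr
          linarith
      _ = Real.sqrt Sigs * ((1 + c)⁻¹ * Real.exp (-(σ * |z|))) * Real.exp
            ((1 - Sigs) / 2 * z ^ 2 - μs * Real.sqrt Sigs * z - μs ^ 2 / 2) := by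
          rw [Real.exp_add]
          ring
      _ ≤ _ := by gcongr
  have hlim : ∀ l : Filter ℝ, Tendsto (fun z : ℝ => |z|) l atTop → Tendsto F l atTop := by
    intro l hl
    have hκ : 0 < (1 - Sigs) / 4 := by linarith
    obtain ⟨c₀, hc₀, M, _, h⟩ := hbound ((1 - Sigs) / 4) hκ (by linarith)
    refine tendsto_atTop_mono' l ?_ (tendsto_mul_exp_mul_sq hc₀ hκ hl)
    filter_upwards [hl.eventually_ge_atTop M] with z hz using h z hz
  exact ⟨hbound, hlim _ tendsto_abs_atTop_atTop, hlim _ tendsto_abs_atBot_atTop⟩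
end

section
/- Let ν > 0 and define the Gamma quantile map τ : (0,1) → (0,∞) by τ(u) = 2 γ_{ν/2}^{-1}( Γ(ν/2) u ), so that τ(u) is the u-quantile of the chi-squared distribution with ν degrees of freedom. Then τ is differentiable on (0,1) with τ'(u) = 2 Γ(ν/2) (τ(u)/2)^{1−ν/2} e^{τ(u)/2}, and it satisfies limsup_{u → 0+} u^{1 − 2/ν} τ'(u) < ∞ and limsup_{u → 1−} (1−u) τ'(u) < ∞. In particular, τ'(u) = O( [min(u, 1−u)]^{-1} ) as u approaches either endpoint. -/
open MeasureTheory Filter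

/-- The lower incomplete gamma function `γ_α(x) = ∫_0^x t^{α-1} e^{-t} dt`. -/
noncomputable def lowerGamma (α x : ℝ) : ℝ :=
  ∫ t in Set.Ioc (0 : ℝ) x, t ^ (α - 1) * Real.exp (-t)

lemma integrableOn_rpow_mul_exp_neg {α : ℝ} (hα : 0 < α) :
    IntegrableOn (fun t : ℝ => t ^ (α - 1) * Real.exp (-t)) (Set.Ioi 0) := by
  simpa only [mul_comm] using Real.GammaIntegral_convergent hα

lemma lowerGamma_of_nonpos (α : ℝ) {x : ℝ} (hx : x ≤ 0) : lowerGamma α x = 0 := by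
  simp [lowerGamma, Set.Ioc_eq_empty_of_le hx]

lemma lowerGamma_mono {α : ℝ} (hα : 0 < α) : Monotone (lowerGamma α) := by
  intro x y hxy
  refine setIntegral_mono_set ((integrableOn_rpow_mul_exp_neg hα).mono_set
    Set.Ioc_subset_Ioi_self) ?_ (Set.Ioc_subset_Ioc_right hxy).eventuallyLE
  filter_upwards [self_mem_ae_restrict measurableSet_Ioc] with t ht
  exact mul_nonneg (Real.rpow_nonneg ht.1.le _) (Real.exp_pos _).le

/-- The integral over `(x, ∞)` of the Gamma density is the complement of the lower incomplete
gamma function. -/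
lemma setIntegral_Ioi_eq_Gamma_sub_lowerGamma {α x : ℝ} (hα : 0 < α) (hx : 0 ≤ x) :
    ∫ t in Set.Ioi x, t ^ (α - 1) * Real.exp (-t) = Real.Gamma α - lowerGamma α x := by
  have hI := integrableOn_rpow_mul_exp_neg hα
  have h := setIntegral_union (Set.Ioc_disjoint_Ioi (le_refl x)) measurableSet_Ioi
    (hI.mono_set Set.Ioc_subset_Ioi_self) (hI.mono_set (Set.Ioi_subset_Ioi hx))
  rw [Set.Ioc_union_Ioi_eq_Ioi hx] at h
  simp only [Real.Gamma_eq_integral hα, mul_comm (Real.exp _)]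
  rw [h, lowerGamma, add_sub_cancel_left]

lemma lowerGamma_lt_Gamma {α x : ℝ} (hα : 0 < α) (hx : 0 ≤ x) :
    lowerGamma α x < Real.Gamma α := by
  rw [← sub_pos, ← setIntegral_Ioi_eq_Gamma_sub_lowerGamma hα hx,
    setIntegral_pos_iff_support_of_nonneg_ae]
  · have hpos : Set.Ioi x ⊆ Function.support fun t : ℝ => t ^ (α - 1) * Real.exp (-t) :=
      fun t ht => (mul_pos (Real.rpow_pos_of_pos (hx.trans_lt ht) _) (Real.exp_pos _)).ne'
    rw [Set.inter_eq_right.mpr hpos]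
    simp
  · filter_upwards [self_mem_ae_restrict measurableSet_Ioi] with t ht
    exact mul_nonneg (Real.rpow_nonneg (hx.trans (le_of_lt ht)) _) (Real.exp_pos _).le
  · exact (integrableOn_rpow_mul_exp_neg hα).mono_set (Set.Ioi_subset_Ioi hx)

lemma hasStrictDerivAt_lowerGamma {α x : ℝ} (hα : 0 < α) (hx : 0 < x) :
    HasStrictDerivAt (lowerGamma α) (x ^ (α - 1) * Real.exp (-x)) x := by
  have hc : ContinuousOn (fun t : ℝ => t ^ (α - 1) * Real.exp (-t)) (Set.Ioi 0) :=
    (continuousOn_id.rpow_const fun t ht => Or.inl (ne_of_gt ht)).mul (by fun_prop)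
  have h := intervalIntegral.integral_hasStrictDerivAt_right
    ((intervalIntegrable_iff_integrableOn_Ioc_of_le hx.le).mpr
      ((integrableOn_rpow_mul_exp_neg hα).mono_set Set.Ioc_subset_Ioi_self))
    (hc.stronglyMeasurableAtFilter isOpen_Ioi x hx) (hc.continuousAt (Ioi_mem_nhds hx))
  refine h.congr_of_eventuallyEq ?_
  filter_upwards [Ioi_mem_nhds hx] with y hy
  exact intervalIntegral.integral_of_le (le_of_lt hy)

lemma setIntegral_Ioc_rpow_sub_one {α x : ℝ} (hα : 0 < α) (hx : 0 ≤ x) :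
    ∫ t in Set.Ioc 0 x, t ^ (α - 1) = x ^ α / α := by
  rw [← intervalIntegral.integral_of_le hx, integral_rpow (Or.inl (by linarith))]
  simp [Real.zero_rpow hα.ne']

lemma integrableOn_Ioc_rpow_sub_one {α x : ℝ} (hα : 0 < α) (hx : 0 ≤ x) :
    IntegrableOn (fun t : ℝ => t ^ (α - 1)) (Set.Ioc 0 x) :=
  (intervalIntegrable_iff_integrableOn_Ioc_of_le hx).mp
    (intervalIntegral.intervalIntegrable_rpow' (by linarith))

lemma lowerGamma_le_rpow_div {α x : ℝ} (hα : 0 < α) (hx : 0 ≤ x) :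
    lowerGamma α x ≤ x ^ α / α := by
  rw [← setIntegral_Ioc_rpow_sub_one hα hx]
  refine setIntegral_mono_on ((integrableOn_rpow_mul_exp_neg hα).mono_set
    Set.Ioc_subset_Ioi_self) (integrableOn_Ioc_rpow_sub_one hα hx) measurableSet_Ioc
    fun t ht => ?_
  exact mul_le_of_le_one_right (Real.rpow_nonneg ht.1.le _)
    (Real.exp_le_one_iff.mpr (by linarith [ht.1]))

lemma exp_neg_mul_rpow_div_le_lowerGamma {α x : ℝ} (hα : 0 < α) (hx : 0 ≤ x) :
    Real.exp (-x) * (x ^ α / α) ≤ lowerGamma α x := by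
  rw [← setIntegral_Ioc_rpow_sub_one hα hx, ← integral_const_mul]
  refine setIntegral_mono_on ((integrableOn_Ioc_rpow_sub_one hα hx).const_mul _)
    ((integrableOn_rpow_mul_exp_neg hα).mono_set Set.Ioc_subset_Ioi_self) measurableSet_Ioc
    fun t ht => ?_
  rw [mul_comm]
  exact mul_le_mul_of_nonneg_left (Real.exp_le_exp.mpr (by linarith [ht.2]))
    (Real.rpow_nonneg ht.1.le _)

lemma rpow_le_rpow_mul_exp_half {β x t : ℝ} (hx : 0 < x) (hβ : 2 * β ≤ x) (hxt : x ≤ t) :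
    t ^ β ≤ x ^ β * Real.exp ((t - x) / 2) := by
  have ht := hx.trans_le hxt
  rw [Real.rpow_def_of_pos ht, Real.rpow_def_of_pos hx, ← Real.exp_add, Real.exp_le_exp]
  have h0 : 0 ≤ Real.log t - Real.log x := sub_nonneg.mpr (Real.log_le_log hx hxt)
  have h1 : x * (Real.log t - Real.log x) ≤ t - x := by
    rw [← Real.log_div ht.ne' hx.ne']
    have h := mul_le_mul_of_nonneg_left (Real.log_le_sub_one_of_pos (div_pos ht hx)) hx.le
    rwa [mul_sub, mul_div_cancel₀ _ hx.ne', mul_one] at h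
  nlinarith [mul_le_mul_of_nonneg_right hβ h0]

/-- Upper tail bound for the Gamma distribution. -/
lemma Gamma_sub_lowerGamma_le {α x : ℝ} (hα : 0 < α) (hx : 0 < x) (hαx : 2 * (α - 1) ≤ x) :
    Real.Gamma α - lowerGamma α x ≤ 2 * x ^ (α - 1) * Real.exp (-x) := by
  have hneg : (-1 / 2 : ℝ) < 0 := by norm_num
  rw [← setIntegral_Ioi_eq_Gamma_sub_lowerGamma hα hx.le]
  calc ∫ t in Set.Ioi x, t ^ (α - 1) * Real.exp (-t)
      ≤ ∫ t in Set.Ioi x, x ^ (α - 1) * Real.exp (-x / 2) * Real.exp (-1 / 2 * t) := by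
        refine setIntegral_mono_on ((integrableOn_rpow_mul_exp_neg hα).mono_set
          (Set.Ioi_subset_Ioi hx.le)) ((integrableOn_exp_mul_Ioi hneg x).const_mul _)
          measurableSet_Ioi fun t ht => ?_
        calc t ^ (α - 1) * Real.exp (-t)
            ≤ x ^ (α - 1) * Real.exp ((t - x) / 2) * Real.exp (-t) := by
              gcongr
              exact rpow_le_rpow_mul_exp_half hx hαx (le_of_lt ht)
          _ = x ^ (α - 1) * Real.exp (-x / 2) * Real.exp (-1 / 2 * t) := by
              rw [mul_assoc, mul_assoc, ← Real.exp_add, ← Real.exp_add]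
              ring_nf
    _ = 2 * x ^ (α - 1) * (Real.exp (-x / 2) * Real.exp (-1 / 2 * x)) := by
        rw [integral_const_mul, integral_exp_mul_Ioi hneg]
        ring
    _ = 2 * x ^ (α - 1) * Real.exp (-x) := by
        rw [← Real.exp_add]
        ring_nf

/-- Points of `(0, 1]` satisfy a two-sided comparison `lowerGamma α x ≍ x ^ α`, which bounds
`u ^ (1 - 1 / α) * x ^ (1 - α)` for `u = lowerGamma α x / Γ(α)`. -/
lemma exists_rpow_lowerGamma_mul_rpow_le {α : ℝ} (hα : 0 < α) :
    ∃ C : ℝ, ∀ x ∈ Set.Ioc (0 : ℝ) 1,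
      (lowerGamma α x / Real.Gamma α) ^ (1 - 1 / α) * x ^ (1 - α) ≤ C := by
  have hΓ := Real.Gamma_pos_of_pos hα
  set a := Real.exp (-1) / α / Real.Gamma α with ha
  have ha0 : 0 < a := by positivity
  obtain ⟨C, hC⟩ := (isCompact_Icc (a := a) (b := 1 / α / Real.Gamma α)).exists_bound_of_continuousOn
    (f := fun r : ℝ => r ^ (1 - 1 / α))
    (continuousOn_id.rpow_const fun r hr => Or.inl (ha0.trans_le hr.1).ne')
  refine ⟨C, fun x hx => ?_⟩
  have hxα : 0 < x ^ α := Real.rpow_pos_of_pos hx.1 _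
  have hlow : Real.exp (-1) * (x ^ α / α) ≤ lowerGamma α x :=
    (mul_le_mul_of_nonneg_right (Real.exp_le_exp.mpr (by linarith [hx.2]))
      (by positivity)).trans (exp_neg_mul_rpow_div_le_lowerGamma hα hx.1.le)
  have hup := lowerGamma_le_rpow_div hα hx.1.le
  have hF : 0 < lowerGamma α x := lt_of_lt_of_le (by positivity) hlow
  have hmem : lowerGamma α x / Real.Gamma α / x ^ α ∈ Set.Icc a (1 / α / Real.Gamma α) := by
    constructor
    · rw [ha, le_div_iff₀ hxα, div_mul_eq_mul_div]
      gcongr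
      linarith [show Real.exp (-1) / α * x ^ α = Real.exp (-1) * (x ^ α / α) by ring]
    · rw [div_le_iff₀ hxα, div_mul_eq_mul_div]
      gcongr
      linarith [show 1 / α * x ^ α = x ^ α / α by ring]
  have h := (le_abs_self _).trans (hC _ hmem)
  have hexp : x ^ (1 - α) = ((x ^ α) ^ (1 - 1 / α))⁻¹ := by
    rw [← Real.rpow_mul hx.1.le, ← Real.rpow_neg hx.1.le]
    congr 1
    field_simp
    ring
  rwa [Real.div_rpow (by positivity) hxα.le, div_eq_mul_inv, ← hexp] at h

/-- the chi-squared (Gam(ν/2,2)) quantile map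
`τ(u) = 2 γ_{ν/2}⁻¹(Γ(ν/2) u)` is differentiable on `(0,1)` with derivative
`τ'(u) = 2 Γ(ν/2) (τ(u)/2)^{1-ν/2} e^{τ(u)/2}`, with `u^{1-2/ν} τ'(u)` bounded as
`u → 0⁺` and `(1-u) τ'(u)` bounded as `u → 1⁻`; in particular
`τ'(u) = O([min(u,1-u)]⁻¹)` near both endpoints. -/
theorem chiSq_quantile_deriv_bounds (ν : ℝ) (hν : 0 < ν) (g : ℝ → ℝ)
    (hg : Set.InvOn g (lowerGamma (ν / 2)) (Set.Ioi 0)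
      (Set.Ioo 0 (Real.Gamma (ν / 2))))
    (τ : ℝ → ℝ) (hτ : ∀ u, τ u = 2 * g (Real.Gamma (ν / 2) * u)) :
    (∀ u ∈ Set.Ioo (0 : ℝ) 1, HasDerivAt τ
      (2 * Real.Gamma (ν / 2) * (τ u / 2) ^ (1 - ν / 2) * Real.exp (τ u / 2)) u) ∧
    (∃ C : ℝ, ∀ᶠ u in nhdsWithin 0 (Set.Ioi 0),
      u ^ (1 - 2 / ν) *
        (2 * Real.Gamma (ν / 2) * (τ u / 2) ^ (1 - ν / 2) * Real.exp (τ u / 2)) ≤ C) ∧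
    (∃ C : ℝ, ∀ᶠ u in nhdsWithin 1 (Set.Iio 1),
      (1 - u) *
        (2 * Real.Gamma (ν / 2) * (τ u / 2) ^ (1 - ν / 2) * Real.exp (τ u / 2)) ≤ C) ∧
    (∃ C : ℝ, ∀ᶠ u in nhdsWithin 0 (Set.Ioi 0) ⊔ nhdsWithin 1 (Set.Iio 1),
      2 * Real.Gamma (ν / 2) * (τ u / 2) ^ (1 - ν / 2) * Real.exp (τ u / 2) ≤
        C * (min u (1 - u))⁻¹) := by
  have hα : 0 < ν / 2 := by positivity
  have hν2 : 2 / ν = 1 / (ν / 2) := by field_simp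
  have hΓ := Real.Gamma_pos_of_pos hα
  have hτg (u : ℝ) : τ u / 2 = g (Real.Gamma (ν / 2) * u) := by rw [hτ]; ring
  simp only [hν2]
  generalize ν / 2 = α at *
  have hval : ∀ u ∈ Set.Ioo (0 : ℝ) 1, lowerGamma α (τ u / 2) = Real.Gamma α * u := by
    intro u hu
    rw [hτg]
    exact hg.2 ⟨mul_pos hΓ hu.1, mul_lt_of_lt_one_right hΓ hu.2⟩
  have hpos : ∀ u ∈ Set.Ioo (0 : ℝ) 1, 0 < τ u / 2 := by
    intro u hu
    by_contra! h
    have := hval u hu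
    rw [lowerGamma_of_nonpos α h] at this
    exact (mul_pos hΓ hu.1).ne this
  have hnear0 : Set.Ioo (0 : ℝ) 1 ∈ nhdsWithin 0 (Set.Ioi 0) := Ioo_mem_nhdsGT one_pos
  have hnear1 : Set.Ioo (0 : ℝ) 1 ∈ nhdsWithin 1 (Set.Iio 1) := Ioo_mem_nhdsLT one_pos
  have hT : ∀ u ∈ Set.Ioo (0 : ℝ) 1,
      0 ≤ 2 * Real.Gamma α * (τ u / 2) ^ (1 - α) * Real.exp (τ u / 2) := by
    intro u hu
    have := hpos u hu
    positivity
  have hzero : ∃ C : ℝ, ∀ᶠ u in nhdsWithin 0 (Set.Ioi 0), u ^ (1 - 1 / α) *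
      (2 * Real.Gamma α * (τ u / 2) ^ (1 - α) * Real.exp (τ u / 2)) ≤ C := by
    obtain ⟨C, hC⟩ := exists_rpow_lowerGamma_mul_rpow_le hα
    refine ⟨2 * Real.Gamma α * Real.exp 1 * C, ?_⟩
    have hF1 : 0 < lowerGamma α 1 :=
      lt_of_lt_of_le (by positivity) (exp_neg_mul_rpow_div_le_lowerGamma hα zero_le_one)
    filter_upwards [hnear0, Ioo_mem_nhdsGT (div_pos hF1 hΓ)] with u hu hu'
    have hx := hpos u hu
    have hx1 : τ u / 2 ≤ 1 := by
      by_contra! h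
      have h1 := lowerGamma_mono hα h.le
      rw [hval u hu] at h1
      have h2 := (lt_div_iff₀ hΓ).mp hu'.2
      linarith
    have hb := hC _ ⟨hx, hx1⟩
    rw [hval u hu, mul_div_cancel_left₀ _ hΓ.ne'] at hb
    have hu0 := hu.1
    calc u ^ (1 - 1 / α) * (2 * Real.Gamma α * (τ u / 2) ^ (1 - α) * Real.exp (τ u / 2))
        = 2 * Real.Gamma α * Real.exp (τ u / 2) * (u ^ (1 - 1 / α) * (τ u / 2) ^ (1 - α)) := by
          ring
      _ ≤ 2 * Real.Gamma α * Real.exp 1 * (u ^ (1 - 1 / α) * (τ u / 2) ^ (1 - α)) := by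
          gcongr
      _ ≤ 2 * Real.Gamma α * Real.exp 1 * C := by gcongr
  have hone : ∃ C : ℝ, ∀ᶠ u in nhdsWithin 1 (Set.Iio 1), (1 - u) *
      (2 * Real.Gamma α * (τ u / 2) ^ (1 - α) * Real.exp (τ u / 2)) ≤ C := by
    refine ⟨4, ?_⟩
    have hA := lowerGamma_lt_Gamma hα (le_max_right (2 * (α - 1)) 0)
    filter_upwards [hnear1, Ioo_mem_nhdsLT ((div_lt_one hΓ).mpr hA)] with u hu hu'
    have hx := hpos u hu
    have hαx : 2 * (α - 1) ≤ τ u / 2 := by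
      refine (le_max_left _ 0).trans ?_
      by_contra! h
      have h1 := lowerGamma_mono hα h.le
      rw [hval u hu] at h1
      have h2 := (div_lt_iff₀ hΓ).mp hu'.1
      linarith
    have hb := Gamma_sub_lowerGamma_le hα hx hαx
    rw [hval u hu] at hb
    calc (1 - u) * (2 * Real.Gamma α * (τ u / 2) ^ (1 - α) * Real.exp (τ u / 2))
        = 2 * (τ u / 2) ^ (1 - α) * Real.exp (τ u / 2) *
            (Real.Gamma α - Real.Gamma α * u) := by ring
      _ ≤ 2 * (τ u / 2) ^ (1 - α) * Real.exp (τ u / 2) *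
            (2 * (τ u / 2) ^ (α - 1) * Real.exp (-(τ u / 2))) := by gcongr
      _ = 4 * ((τ u / 2) ^ (1 - α) * (τ u / 2) ^ (α - 1)) *
            (Real.exp (τ u / 2) * Real.exp (-(τ u / 2))) := by ring
      _ = 4 := by
          rw [← Real.rpow_add hx, ← Real.exp_add]
          simp
  refine ⟨fun u hu => ?_, hzero, hone, ?_⟩
  · have hx := hpos u hu
    have hd := (hasStrictDerivAt_lowerGamma hα hx).to_local_left_inverse
      (mul_pos (Real.rpow_pos_of_pos hx _) (Real.exp_pos _)).ne' (g := g)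
      (by filter_upwards [Ioi_mem_nhds hx] with y hy using hg.1 hy)
    rw [hval u hu] at hd
    have hcomp := (hd.hasDerivAt.comp u ((hasDerivAt_id u).const_mul (Real.Gamma α))).const_mul 2
    refine (hcomp.congr_of_eventuallyEq (.of_forall hτ)).congr_deriv ?_
    rw [mul_inv, ← Real.rpow_neg hx.le, Real.exp_neg, inv_inv, neg_sub]
    ring
  · obtain ⟨C₀, hC₀⟩ := hzero
    obtain ⟨C₁, hC₁⟩ := hone
    refine ⟨max (max C₀ 0) C₁, eventually_sup.mpr ⟨?_, ?_⟩⟩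
    · filter_upwards [hnear0, hC₀] with u hu hb
      rw [← div_eq_mul_inv, le_div_iff₀ (lt_min hu.1 (sub_pos.mpr hu.2)), mul_comm]
      refine le_trans ?_ (le_max_left _ _)
      refine (mul_le_mul_of_nonneg_right (min_le_left _ _) (hT u hu)).trans ?_
      have hsplit : u = u ^ (1 / α) * u ^ (1 - 1 / α) := by
        rw [← Real.rpow_add hu.1]
        simp
      have hle : u ^ (1 / α) ≤ 1 := Real.rpow_le_one hu.1.le hu.2.le (by positivity)
      nth_rewrite 1 [hsplit]
      rw [mul_assoc]
      exact (mul_le_mul_of_nonneg_left (hb.trans (le_max_left _ 0))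
        (Real.rpow_nonneg hu.1.le _)).trans (mul_le_of_le_one_left (le_max_right _ _) hle)
    · filter_upwards [hnear1, hC₁] with u hu hb
      rw [← div_eq_mul_inv, le_div_iff₀ (lt_min hu.1 (sub_pos.mpr hu.2)), mul_comm]
      exact (mul_le_mul_of_nonneg_right (min_le_right _ _) (hT u hu)).trans
        (hb.trans (le_max_right _ _))
end
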